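/- Let m be a universal semimeasure with a fixed approximation (m_t) from below. There exist a sequence of natural numbers t_1, t_2, … and a computable function f : ℕ → ℕ such that: (1) for every k ≥ 1, ∑' over {x : m(x) ≥ 2 · m_{t_k}(x)} of m(x) is at most 2^{−k+1}; and (2) for all sufficiently large k, m_{f(t_k)}(t_k) ≥ 2^{−k}/k², where m_s(t) denotes m_s evaluated at the string consisting of t zeros. (The paper's displayed lemma writes the second inequality with ≤, but the proof and its subsequent use establish the lower bound ≥.) -/

import Mathlib

open scoped ENNReal NNReal

/-- Interpret a rational approximation value as an extended nonnegative real. -/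
noncomputable def qval (q : ℚ) : ℝ≥0∞ := ENNReal.ofReal q

/-- Interpret a value in `ℚ≥0 ∪ {∞}` (with nonnegativity required separately)
as an extended nonnegative real; `none` stands for `∞`. -/
noncomputable def qtval (q : Option ℚ) : ℝ≥0∞ := q.elim ⊤ (fun a => ENNReal.ofReal a)

/-- A (discrete) semimeasure on bitstrings. -/
def IsSemimeasure (P : List Bool → ℝ≥0∞) : Prop := ∑' x, P x ≤ 1

/-- `Ps` is a computable approximation of `P` from below (by nonnegative rationals,
nondecreasing in the stage). -/
def IsApproxFromBelow (P : List Bool → ℝ≥0∞) (Ps : List Bool → ℕ → ℚ) : Prop :=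
  Computable (fun p : List Bool × ℕ => Ps p.1 p.2) ∧
  (∀ x s, 0 ≤ Ps x s) ∧
  (∀ x, Monotone fun s => Ps x s) ∧
  (∀ x, P x = ⨆ s, qval (Ps x s))

/-- `P` is lower semicomputable. -/
def LowerSemicomputable (P : List Bool → ℝ≥0∞) : Prop := ∃ Ps, IsApproxFromBelow P Ps

/-- `es` is a computable approximation of `e` from above (by values in `ℚ≥0 ∪ {∞}`,
nonincreasing in the stage). -/
def IsApproxFromAbove (e : List Bool → ℝ≥0∞) (es : List Bool → ℕ → Option ℚ) : Prop :=
  Computable (fun p : List Bool × ℕ => es p.1 p.2) ∧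
  (∀ x s, ∀ a ∈ es x s, (0:ℚ) ≤ a) ∧
  (∀ x, Antitone fun s => qtval (es x s)) ∧
  (∀ x, e x = ⨅ s, qtval (es x s))

/-- `e` is upper semicomputable. -/
def UpperSemicomputable (e : List Bool → ℝ≥0∞) : Prop := ∃ es, IsApproxFromAbove e es

/-- `e` is a sumtest for the semimeasure `P`. -/
def IsSumtest (P e : List Bool → ℝ≥0∞) : Prop := ∑' x, P x * e x ≤ 1

/-- `m` is a universal (lower semicomputable) semimeasure. -/
def IsUniversalSemimeasure (m : List Bool → ℝ≥0∞) : Prop :=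
  IsSemimeasure m ∧ LowerSemicomputable m ∧
  ∀ P, IsSemimeasure P → LowerSemicomputable P → ∃ c : ℝ≥0, 0 < c ∧ ∀ x, P x ≤ c * m x

/-- A conditional semimeasure `m(·|·)`. -/
def IsCondSemimeasure (m : List Bool → ℕ → ℝ≥0∞) : Prop := ∀ s, ∑' x, m x s ≤ 1

/-- `ms` is a computable approximation from below of the conditional semimeasure `m`:
`ms t x s` approximates `m(x|s)`, nondecreasing in the stage `t`. -/
def IsCondApproxFromBelow (m : List Bool → ℕ → ℝ≥0∞) (ms : ℕ → List Bool → ℕ → ℚ) : Prop :=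
  Computable (fun p : ℕ × List Bool × ℕ => ms p.1 p.2.1 p.2.2) ∧
  (∀ t x s, 0 ≤ ms t x s) ∧
  (∀ x s, Monotone fun t => ms t x s) ∧
  (∀ x s, m x s = ⨆ t, qval (ms t x s))

/-- The conditional semimeasure `m` is lower semicomputable (jointly). -/
def CondLowerSemicomputable (m : List Bool → ℕ → ℝ≥0∞) : Prop :=
  ∃ ms, IsCondApproxFromBelow m ms

/-- `m(·|·)` is a universal lower semicomputable conditional semimeasure. -/
def IsUniversalCondSemimeasure (m : List Bool → ℕ → ℝ≥0∞) : Prop :=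
  IsCondSemimeasure m ∧ CondLowerSemicomputable m ∧
  ∀ m', IsCondSemimeasure m' → CondLowerSemicomputable m' →
    ∃ c : ℝ≥0, 0 < c ∧ ∀ x s, m' x s ≤ c * m x s

/-- The string consisting of `t` zeros, representing the natural number `t`. -/
def zeros (t : ℕ) : List Bool := List.replicate t false

/-! ### Computability of rational arithmetic -/

/-- The code of a rational as a pair of codes of its numerator and denominator. -/
def Rat.pairCode (q : ℚ) : ℕ := Nat.pair (Encodable.encode q.num) q.den

/-- The predicate that a natural number is the code of a reduced fraction. -/
def IsRatPairCode (n : ℕ) : Prop :=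
  0 < n.unpair.2 ∧ ∀ d < n + 2, d ≤ 1 ∨ ¬ (d ∣ (n.unpair.1 + 1) / 2 ∧ d ∣ n.unpair.2)

lemma Int.natAbs_eq_encode (z : ℤ) : z.natAbs = (Encodable.encode z + 1) / 2 := by
  cases z with
  | ofNat n =>
    have : Encodable.encode (Int.ofNat n) = 2 * n := rfl
    rw [this]; simp; omega
  | negSucc n =>
    have : Encodable.encode (Int.negSucc n) = 2 * n + 1 := rfl
    rw [this]; simp; omega

lemma Int.toNat_eq_encode (z : ℤ) :
    z.toNat = if Encodable.encode z % 2 = 0 then Encodable.encode z / 2 else 0 := by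
  cases z with
  | ofNat n =>
    have : Encodable.encode (Int.ofNat n) = 2 * n := rfl
    rw [this]; simp
  | negSucc n =>
    have : Encodable.encode (Int.negSucc n) = 2 * n + 1 := rfl
    rw [this, if_neg (by omega)]; simp

lemma Int.exists_encode_eq (n : ℕ) : ∃ z : ℤ, Encodable.encode z = n := by
  rcases Nat.even_or_odd' n with ⟨k, rfl | rfl⟩
  · exact ⟨Int.ofNat k, rfl⟩
  · exact ⟨Int.negSucc k, rfl⟩

lemma isRatPairCode_iff (n : ℕ) : IsRatPairCode n ↔ ∃ q : ℚ, q.pairCode = n := by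
  constructor
  · rintro ⟨h0, h⟩
    obtain ⟨z, hz⟩ := Int.exists_encode_eq n.unpair.1
    have hc : z.natAbs.Coprime n.unpair.2 := by
      refine Nat.Coprime.symm (Nat.coprime_of_dvd fun d hd h1 h2 => ?_)
      rw [Int.natAbs_eq_encode, hz] at h2
      rcases h d (by have := Nat.le_of_dvd h0 h1; have := Nat.unpair_right_le n; omega) with h' | h'
      · exact absurd hd.two_le (by omega)
      · exact h' ⟨h2, h1⟩
    refine ⟨⟨z, n.unpair.2, h0.ne', hc⟩, ?_⟩
    simp [Rat.pairCode, hz]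
  · rintro ⟨q, rfl⟩
    simp only [IsRatPairCode, Rat.pairCode, Nat.unpair_pair, ← Int.natAbs_eq_encode]
    refine ⟨q.den_pos, fun d _ => ?_⟩
    by_contra! h
    have := Nat.dvd_gcd h.2.1 h.2.2
    rw [q.reduced] at this
    have := Nat.le_of_dvd one_pos this
    omega

lemma primrecPred_isRatPairCode : PrimrecPred IsRatPairCode := by
  have h1 : PrimrecRel fun d n : ℕ => d ≤ 1 ∨ ¬ (d ∣ (n.unpair.1 + 1) / 2 ∧ d ∣ n.unpair.2) := by
    have hdvd : PrimrecRel fun d n : ℕ => d ∣ n :=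
      (Primrec.eq.comp (Primrec.nat_mod.comp Primrec.snd Primrec.fst) (Primrec.const 0)).of_eq
        fun p => (Nat.dvd_iff_mod_eq_zero).symm
    have ha : Primrec fun p : ℕ × ℕ => (p.2.unpair.1 + 1) / 2 :=
      Primrec.nat_div.comp (Primrec.succ.comp (Primrec.fst.comp (Primrec.unpair.comp Primrec.snd)))
        (Primrec.const 2)
    have hb : Primrec fun p : ℕ × ℕ => p.2.unpair.2 :=
      Primrec.snd.comp (Primrec.unpair.comp Primrec.snd)
    exact (Primrec.nat_le.comp Primrec.fst (Primrec.const 1)).or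
      ((hdvd.comp Primrec.fst ha).and (hdvd.comp Primrec.fst hb)).not
  have h2 := h1.forall_lt.comp (f := fun n : ℕ => n + 2) (g := fun n : ℕ => n)
    (Primrec.succ.comp Primrec.succ) Primrec.id
  exact (Primrec.nat_lt.comp (Primrec.const 0) (Primrec.snd.comp Primrec.unpair)).and h2

lemma Rat.encode_eq_count [DecidablePred IsRatPairCode] (q : ℚ) :
    @Encodable.encode ℚ Primcodable.toEncodable q = Nat.count IsRatPairCode q.pairCode := by
  have h : @Encodable.encode ℚ Primcodable.toEncodable q = (List.range q.pairCode).countP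
    (fun y => @decide _ (@Encodable.decidableRangeEncode ℚ Rat.instEncodable y)) := rfl
  rw [h, Nat.count]
  congr 1
  funext y
  simp only [decide_eq_decide, isRatPairCode_iff]
  rfl

lemma computable_pairCode : Computable Rat.pairCode := by
  classical
  have hp : Computable fun n => decide (IsRatPairCode n) :=
    primrecPred_isRatPairCode.decide.to_comp
  have hcount : Primrec fun n => Nat.count IsRatPairCode n := by
    refine (Primrec.nat_rec₁ (f := fun n c => c + if IsRatPairCode n then 1 else 0) 0 ?_).of_eq
      fun n => ?_
    · exact Primrec.nat_add.comp Primrec.snd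
        (Primrec.ite (primrecPred_isRatPairCode.comp Primrec.fst)
          (Primrec.const 1) (Primrec.const 0))
    · induction n with
      | zero => simp
      | succ n ih => rw [Nat.count_succ, ← ih]
  have hP : ComputablePred fun p : ℚ × ℕ =>
      IsRatPairCode p.2 ∧ Nat.count IsRatPairCode p.2 =
        @Encodable.encode ℚ Primcodable.toEncodable p.1 :=
    ⟨inferInstance, ((primrecPred_isRatPairCode.comp Primrec.snd).and
      (Primrec.eq.comp (hcount.comp Primrec.snd)
        (Primrec.encode.comp Primrec.fst))).decide.to_comp⟩
  have hex : ∀ q : ℚ, ∃ n,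
      IsRatPairCode n ∧ Nat.count IsRatPairCode n =
        @Encodable.encode ℚ Primcodable.toEncodable q := fun q =>
    ⟨q.pairCode, (isRatPairCode_iff _).2 ⟨q, rfl⟩, (Rat.encode_eq_count q).symm⟩
  refine (Computable.find (P := fun (q : ℚ) n =>
    IsRatPairCode n ∧ Nat.count IsRatPairCode n =
        @Encodable.encode ℚ Primcodable.toEncodable q) hP hex).of_eq fun q => ?_
  have h := Nat.find_spec (hex q)
  exact Nat.count_injective h.1 ((isRatPairCode_iff _).2 ⟨q, rfl⟩)
    (h.2.trans (Rat.encode_eq_count q))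

lemma computable_rat_den : Computable Rat.den :=
  ((Primrec.snd.comp Primrec.unpair).to_comp.comp computable_pairCode).of_eq fun q => by
    simp [Rat.pairCode]

lemma computable_rat_num_natAbs : Computable fun q : ℚ => q.num.natAbs :=
  (((Primrec.nat_div.comp (Primrec.succ.comp (Primrec.fst.comp Primrec.unpair))
    (Primrec.const 2)).to_comp).comp computable_pairCode).of_eq fun q => by
      simp [Rat.pairCode, Int.natAbs_eq_encode]

lemma computable_rat_num_toNat : Computable fun q : ℚ => q.num.toNat := by
  have h : Primrec fun n : ℕ => if n.unpair.1 % 2 = 0 then n.unpair.1 / 2 else 0 :=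
    have h1 := Primrec.fst.comp Primrec.unpair
    Primrec.ite (Primrec.eq.comp (Primrec.nat_mod.comp h1 (Primrec.const 2)) (Primrec.const 0))
      (Primrec.nat_div.comp h1 (Primrec.const 2)) (Primrec.const 0)
  exact (h.to_comp.comp computable_pairCode).of_eq fun q => by
    simp [Rat.pairCode, Int.toNat_eq_encode]

lemma primrec_two_pow : Primrec fun n : ℕ => 2 ^ n := by
  refine (Primrec.nat_rec₁ (f := fun _ c => c * 2) 1 ?_).of_eq fun n => ?_
  · exact Primrec.nat_mul.comp Primrec.snd (Primrec.const 2)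
  · induction n with
    | zero => rfl
    | succ n ih => rw [pow_succ, ← ih]

lemma computable_natCast_div_natCast : Computable fun p : ℕ × ℕ => (p.1 : ℚ) / (p.2 + 1 : ℕ) := by
  have hden : Computable fun a : (ℕ × ℕ) × ℕ => (Denumerable.ofNat ℚ a.2).den :=
    computable_rat_den.comp ((Computable.ofNat ℚ).comp Computable.snd)
  have hnum : Computable fun a : (ℕ × ℕ) × ℕ => (Denumerable.ofNat ℚ a.2).num.toNat :=
    computable_rat_num_toNat.comp ((Computable.ofNat ℚ).comp Computable.snd)
  have habs : Computable fun a : (ℕ × ℕ) × ℕ => (Denumerable.ofNat ℚ a.2).num.natAbs :=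
    computable_rat_num_natAbs.comp ((Computable.ofNat ℚ).comp Computable.snd)
  let P : ℕ × ℕ → ℕ → Prop := fun p i =>
    (Denumerable.ofNat ℚ i).num.natAbs = (Denumerable.ofNat ℚ i).num.toNat ∧
      (Denumerable.ofNat ℚ i).num.toNat * (p.2 + 1) = p.1 * (Denumerable.ofNat ℚ i).den
  have hPd : DecidableRel P := fun p i => by unfold P; infer_instance
  have hP_iff : ∀ p i, P p i ↔ Denumerable.ofNat ℚ i = (p.1 : ℚ) / (p.2 + 1 : ℕ) := by
    intro p i
    generalize hq : Denumerable.ofNat ℚ i = q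
    simp only [P, hq]
    have hpos : 0 ≤ q → ((q.num.toNat : ℕ) : ℚ) = q.num := fun h0 => by
      exact_mod_cast Int.toNat_of_nonneg (Rat.num_nonneg.2 h0)
    have hd : (q.den : ℚ) ≠ 0 := by exact_mod_cast q.den_nz
    have hp : ((p.2 + 1 : ℕ) : ℚ) ≠ 0 := by positivity
    have key : 0 ≤ q → (q.num.toNat * (p.2 + 1) = p.1 * q.den ↔ q = (p.1 : ℚ) / (p.2 + 1 : ℕ)) := by
      intro h0
      conv_rhs => rw [← Rat.num_div_den q, div_eq_div_iff hd hp, ← hpos h0]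
      exact_mod_cast Iff.rfl
    constructor
    · rintro ⟨h1, h2⟩
      exact (key (Rat.num_nonneg.1 (by omega))).1 h2
    · intro h
      have h0 : 0 ≤ q := h ▸ by positivity
      exact ⟨by have := Rat.num_nonneg.2 h0; omega, (key h0).2 h⟩
  have hP : ComputablePred fun p : (ℕ × ℕ) × ℕ => P p.1 p.2 := by
    refine ⟨fun p => hPd p.1 p.2, ?_⟩
    have heq : Computable₂ fun a b : ℕ => decide (a = b) := Primrec.eq.decide.to_comp
    have h1 := heq.comp habs hnum
    have h2 := heq.comp
      (Primrec.nat_mul.to_comp.comp hnum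
        (Computable.succ.comp (Computable.snd.comp Computable.fst)))
      (Primrec.nat_mul.to_comp.comp (Computable.fst.comp Computable.fst) hden)
    exact (Primrec.and.to_comp.comp h1 h2).of_eq fun p => by
      simp [P]
  have hex : ∀ p, ∃ i, P p i := fun p =>
    ⟨@Encodable.encode ℚ Primcodable.toEncodable ((p.1 : ℚ) / (p.2 + 1 : ℕ)),
      (hP_iff _ _).2 (Denumerable.ofNat_encode _)⟩
  exact ((Computable.ofNat ℚ).comp (Computable.find hP hex)).of_eq fun p =>
    (hP_iff _ _).1 (Nat.find_spec (hex p))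

lemma Rat.natCast_toNat_num_div_den {q : ℚ} (hq : 0 ≤ q) : (q.num.toNat : ℚ) / q.den = q := by
  have : ((q.num.toNat : ℕ) : ℚ) = q.num := by
    exact_mod_cast Int.toNat_of_nonneg (Rat.num_nonneg.2 hq)
  rw [this, Rat.num_div_den]

lemma Rat.num_den_le_iff {a b : ℚ} (C : ℕ) (ha : 0 ≤ a) (hb : 0 ≤ b) :
    a.num.toNat * b.den ≤ C * b.num.toNat * a.den ↔ a ≤ C * b := by
  have hda : (0 : ℚ) < a.den := by exact_mod_cast a.den_pos
  have hdb : (0 : ℚ) < b.den := by exact_mod_cast b.den_pos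
  conv_rhs =>
    rw [← Rat.natCast_toNat_num_div_den ha, ← Rat.natCast_toNat_num_div_den hb,
      ← mul_div_assoc, div_le_div_iff₀ hda hdb]
  exact_mod_cast Iff.rfl

/-- The integer part of `2 ^ s * q`, for nonnegative `q`. -/
def dyadicFloor (q : ℚ) (s : ℕ) : ℕ := q.num.toNat * 2 ^ s / q.den

lemma computable_dyadicFloor : Computable₂ dyadicFloor :=
  Primrec.nat_div.to_comp.comp
    (Primrec.nat_mul.to_comp.comp (computable_rat_num_toNat.comp Computable.fst)
      (primrec_two_pow.to_comp.comp Computable.snd))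
    (computable_rat_den.comp Computable.fst)

lemma dyadicFloor_eq_floor {q : ℚ} (hq : 0 ≤ q) (s : ℕ) : dyadicFloor q s = ⌊q * 2 ^ s⌋₊ := by
  have h : q * 2 ^ s = ((q.num.toNat * 2 ^ s : ℕ) : ℚ) / (q.den : ℕ) := by
    push_cast
    rw [mul_div_right_comm, Rat.natCast_toNat_num_div_den hq]
  rw [h, Nat.floor_div_eq_div, dyadicFloor]

/-! ### A computable weight that is large whenever a dyadic approximation increases -/

lemma Computable.sum_range {α : Type*} [Primcodable α] {f : α → ℕ} {g : α → ℕ → ℕ}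
    (hf : Computable f) (hg : Computable₂ g) :
    Computable fun a => ∑ i ∈ Finset.range (f a), g a i := by
  have hstep : Computable₂ fun (a : α) (p : ℕ × ℕ) => p.2 + g a p.1 :=
    Primrec.nat_add.to_comp.comp (Computable.snd.comp Computable.snd)
      (hg.comp Computable.fst (Computable.fst.comp Computable.snd))
  refine (Computable.nat_rec (g := fun _ => 0) hf (Computable.const 0) hstep).of_eq fun a => ?_
  induction f a with
  | zero => rfl
  | succ n ih => rw [Finset.sum_range_succ, ← ih]

/-- The integer part of `2 ^ k * (M t / 2 ^ t)` once `t` exceeds `k`, and `0` before. -/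
def dyadicLevel (M : ℕ → ℕ) (k t : ℕ) : ℕ := if k < t then M t / 2 ^ (t - k) else 0

lemma computable_dyadicLevel {M : ℕ → ℕ} (hM : Computable M) :
    Computable₂ fun t k => dyadicLevel M k t := by
  have h : Primrec fun p : ℕ × ℕ × ℕ => if p.1 < p.2.1 then p.2.2 / 2 ^ (p.2.1 - p.1) else 0 :=
    have h1 : Primrec fun p : ℕ × ℕ × ℕ => p.2.1 := Primrec.fst.comp Primrec.snd
    Primrec.ite (Primrec.nat_lt.comp Primrec.fst h1)
      (Primrec.nat_div.comp (Primrec.snd.comp Primrec.snd)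
        (primrec_two_pow.comp (Primrec.nat_sub.comp h1 Primrec.fst)))
      (Primrec.const 0)
  exact h.to_comp.comp (Computable.pair Computable.snd
    (Computable.pair Computable.fst (hM.comp Computable.fst)))

lemma dyadicLevel_mono {M : ℕ → ℕ} (hM : ∀ t, 2 * M t ≤ M (t + 1)) (k : ℕ) :
    Monotone (dyadicLevel M k) := by
  refine monotone_nat_of_le_succ fun t => ?_
  unfold dyadicLevel
  split_ifs with h1 h2 h2
  · rw [show t + 1 - k = (t - k) + 1 by omega, pow_succ', ← Nat.mul_div_mul_left (M t) _ two_pos]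
    exact Nat.div_le_div_right (hM t)
  · omega
  · exact Nat.zero_le _
  · exact le_rfl

lemma dyadicLevel_le {M : ℕ → ℕ} (hM : ∀ t, M t ≤ 2 ^ t) (k t : ℕ) :
    dyadicLevel M k t ≤ 2 ^ k := by
  unfold dyadicLevel
  split_ifs with h
  · refine (Nat.div_le_div_right (hM t)).trans ?_
    rw [Nat.pow_div (by omega) two_pos]
    exact Nat.pow_le_pow_right two_pos (by omega)
  · exact Nat.zero_le _

lemma sum_dyadicLevel_sub {M : ℕ → ℕ} (hM : ∀ t, 2 * M t ≤ M (t + 1)) (k T : ℕ) :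
    ∑ t ∈ Finset.range (T + 1), (dyadicLevel M k t - dyadicLevel M k (t - 1)) =
      dyadicLevel M k T := by
  induction T with
  | zero => simp [dyadicLevel]
  | succ T ih =>
    rw [Finset.sum_range_succ, ih]
    have := dyadicLevel_mono hM k (Nat.le_succ T)
    simp only [Nat.add_sub_cancel, Nat.succ_eq_add_one] at *
    omega

/-- The reciprocal weight of a dyadic interval of length `2 ^ (-k)`. -/
def levelCost (k : ℕ) : ℕ := 2 ^ k * ((k + 1) * (k.sqrt + 1))

lemma levelCost_pos (k : ℕ) : 0 < levelCost k := by unfold levelCost; positivity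

lemma levelCost_le {k t : ℕ} (h : k < t) : levelCost k ≤ 2 ^ t * ((t + 1) * (t + 1)) := by
  unfold levelCost
  have := Nat.sqrt_le_self k
  gcongr <;> omega

lemma primrec_levelCost : Primrec levelCost :=
  Primrec.nat_mul.comp primrec_two_pow (Primrec.nat_mul.comp Primrec.succ
    (Primrec.succ.comp Primrec.nat_sqrt))

lemma exists_sum_two_pow_div_levelCost_le :
    ∃ D : ℕ, 0 < D ∧ ∀ T : ℕ, ∑ k ∈ Finset.range T, (2 : ℚ) ^ k / levelCost k ≤ D := by
  have hs : Summable fun k : ℕ => 1 / ((k + 1 : ℕ) : ℝ) ^ (3 / 2 : ℝ) :=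
    (summable_nat_add_iff 1).2 (Real.summable_one_div_nat_rpow.2 (by norm_num))
  obtain ⟨D, hD⟩ := exists_nat_ge (∑' k : ℕ, 1 / ((k + 1 : ℕ) : ℝ) ^ (3 / 2 : ℝ))
  refine ⟨D + 1, D.succ_pos, fun T => ?_⟩
  suffices h : ∑ k ∈ Finset.range T, (2 : ℝ) ^ k / levelCost k ≤ D by
    have h' : ((∑ k ∈ Finset.range T, (2 : ℚ) ^ k / levelCost k : ℚ) : ℝ) ≤ (D : ℚ) := by
      push_cast
      exact h
    have h'' := Rat.cast_le.1 h'
    push_cast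
    linarith
  refine le_trans (Finset.sum_le_sum fun k _ => ?_)
    ((hs.sum_le_tsum (Finset.range T) fun k _ => by positivity).trans hD)
  have h1 : ((k + 1 : ℕ) : ℝ) ^ (3 / 2 : ℝ) ≤ ((k + 1) * (k.sqrt + 1) : ℕ) := by
    rw [show (3 / 2 : ℝ) = 1 + 1 / 2 by norm_num, Real.rpow_add (by positivity), Real.rpow_one,
      ← Real.sqrt_eq_rpow]
    push_cast
    gcongr
    rw [Real.sqrt_le_left (by positivity), sq]
    exact_mod_cast Nat.succ_le_succ_sqrt k
  rw [levelCost, Nat.cast_mul, ← div_div, Nat.cast_pow, Nat.cast_ofNat, div_self (by positivity)]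
  exact one_div_le_one_div_of_le (by positivity) h1

lemma exists_computable_weight {M : ℕ → ℕ} (hM : Computable M)
    (hM2 : ∀ t, 2 * M t ≤ M (t + 1)) (hM1 : ∀ t, M t ≤ 2 ^ t) :
    ∃ (W : ℕ → ℚ) (D : ℕ), 0 < D ∧ Computable W ∧ (∀ t, 0 ≤ W t) ∧
      (∀ T, ∑ t ∈ Finset.range T, W t ≤ 1) ∧
      ∀ k t, k < t → dyadicLevel M k (t - 1) < dyadicLevel M k t →
        1 / (D * levelCost k : ℚ) ≤ W t := by
  obtain ⟨D, hD0, hD⟩ := exists_sum_two_pow_div_levelCost_le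
  let Q : ℕ → ℕ := fun t => 2 ^ t * ((t + 1) * (t + 1))
  have hQ0 : ∀ t, 0 < Q t := fun t => by positivity
  let inc : ℕ → ℕ → ℕ := fun k t => dyadicLevel M k t - dyadicLevel M k (t - 1)
  let p : ℕ → ℕ := fun t => ∑ k ∈ Finset.range t, Q t / levelCost k * inc k t
  have hQ : Primrec Q := Primrec.nat_mul.comp primrec_two_pow
    (Primrec.nat_mul.comp Primrec.succ Primrec.succ)
  have hp : Computable p := by
    refine Computable.sum_range Computable.id ?_
    exact Primrec.nat_mul.to_comp.comp
      (Primrec.nat_div.comp (hQ.comp Primrec.fst) (primrec_levelCost.comp Primrec.snd)).to_comp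
      (Primrec.nat_sub.to_comp.comp
        ((computable_dyadicLevel hM).comp Computable.fst Computable.snd)
        ((computable_dyadicLevel hM).comp (Computable.pred.comp Computable.fst) Computable.snd))
  have hDq : (0 : ℚ) < D := by exact_mod_cast hD0
  refine ⟨fun t => (p t : ℚ) / (Q t * D), 2 * D, by omega, ?_, fun t => by positivity, ?_, ?_⟩
  · refine (computable_natCast_div_natCast.comp (Computable.pair hp (Computable.pred.comp
      (Primrec.nat_mul.comp hQ (Primrec.const D)).to_comp))).of_eq fun t => ?_
    have : Nat.pred (Q t * D) + 1 = Q t * D := Nat.succ_pred_eq_of_pos (Nat.mul_pos (hQ0 t) hD0)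
    simp only [this]
    push_cast
    rfl
  · intro T
    have h1 : ∀ t ∈ Finset.range T, (p t : ℚ) / (Q t * D) ≤
        ∑ k ∈ Finset.range T, (inc k t : ℚ) / levelCost k / D := by
      intro t ht
      have hQt : (0 : ℚ) < Q t := by exact_mod_cast hQ0 t
      rw [← div_div, ← Finset.sum_div]
      gcongr
      simp only [p, Nat.cast_sum, Finset.sum_div]
      refine (Finset.sum_le_sum fun k _ => ?_).trans
        (Finset.sum_le_sum_of_subset_of_nonneg
          (Finset.range_mono (Finset.mem_range.1 ht).le) fun k _ _ => by positivity)
      have hk : (0 : ℚ) < levelCost k := by exact_mod_cast levelCost_pos k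
      rw [Nat.cast_mul, div_le_div_iff₀ hQt hk, mul_right_comm, mul_comm (inc k t : ℚ)]
      gcongr
      exact_mod_cast Nat.div_mul_le_self (Q t) (levelCost k)
    refine (Finset.sum_le_sum h1).trans ?_
    rw [Finset.sum_comm]
    have h2 : ∀ k ∈ Finset.range T, ∑ t ∈ Finset.range T, (inc k t : ℚ) / levelCost k / D ≤
        (2 : ℚ) ^ k / levelCost k / D := by
      intro k _
      rw [← Finset.sum_div, ← Finset.sum_div]
      gcongr
      have h3 : ∑ t ∈ Finset.range T, inc k t ≤ 2 ^ k :=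
        (Finset.sum_le_sum_of_subset (Finset.range_mono T.le_succ)).trans
          ((sum_dyadicLevel_sub hM2 k T).le.trans (dyadicLevel_le hM1 k T))
      exact_mod_cast h3
    refine (Finset.sum_le_sum h2).trans ?_
    rw [← Finset.sum_div]
    exact (div_le_one hDq).2 (hD T)
  · intro k t hkt hlt
    have hQt : (0 : ℚ) < Q t := by exact_mod_cast hQ0 t
    have hk : (0 : ℚ) < levelCost k := by exact_mod_cast levelCost_pos k
    have h1 : Q t ≤ 2 * (Q t / levelCost k) * levelCost k := by
      have h2 := Nat.lt_div_mul_add (a := Q t) (levelCost_pos k)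
      have h3 : 1 ≤ Q t / levelCost k := Nat.div_pos (levelCost_le hkt) (levelCost_pos k)
      nlinarith [levelCost_pos k]
    have h2 : Q t / levelCost k ≤ p t :=
      (Nat.le_mul_of_pos_right _ (Nat.sub_pos_of_lt hlt)).trans
        (Finset.single_le_sum (f := fun k => Q t / levelCost k * inc k t)
          (fun _ _ => Nat.zero_le _) (Finset.mem_range.2 hkt))
    have h3 : (Q t : ℚ) ≤ 2 * p t * levelCost k := by
      have : Q t ≤ 2 * p t * levelCost k := h1.trans (by gcongr)
      exact_mod_cast this
    rw [div_le_div_iff₀ (by positivity) (by positivity)]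
    push_cast
    nlinarith

/-! ### Stages reaching a computable weight -/

lemma zeros_injective : Function.Injective zeros := fun a b h => by
  simpa [zeros] using congrArg List.length h

lemma computable_zeros : Computable zeros := by
  refine (Primrec.nat_rec₁ (f := fun _ l => false :: l) [] ?_).to_comp.of_eq fun n => ?_
  · exact Primrec.list_cons.comp (Primrec.const false) Primrec.snd
  · induction n with
    | zero => rfl
    | succ n ih => exact congrArg (false :: ·) ih

lemma exists_computable_stage {m : List Bool → ℝ≥0∞} {mt : List Bool → ℕ → ℚ}
    (hm : IsUniversalSemimeasure m) (hmt : IsApproxFromBelow m mt) {W : ℕ → ℚ}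
    (hW : Computable W) (hW0 : ∀ t, 0 ≤ W t)
    (hW1 : ∀ T, ∑ t ∈ Finset.range T, W t ≤ 1) :
    ∃ (c : ℕ) (f : ℕ → ℕ), 0 < c ∧ Computable f ∧ ∀ t, W t ≤ c * mt (zeros t) (f t) := by
  obtain ⟨hsemi, -, huniv⟩ := hm
  obtain ⟨hcomp, hnn, -, hsup⟩ := hmt
  let P : List Bool → ℚ := fun x => if x = zeros x.length then W x.length else 0
  have hPz : ∀ t, P (zeros t) = W t := fun t => by simp [P, zeros]
  have hPsemi : IsSemimeasure fun x => qval (P x) := by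
    have hsupp : Function.support (fun x => qval (P x)) ⊆ Set.range zeros := by
      intro x hx
      by_contra h
      refine hx ?_
      have : ¬ x = zeros x.length := fun h' => h ⟨_, h'.symm⟩
      simp [P, this, qval]
    unfold IsSemimeasure
    rw [← zeros_injective.tsum_eq hsupp]
    refine ENNReal.tsum_le_of_sum_range_le fun T => ?_
    simp only [hPz, qval]
    rw [← ENNReal.ofReal_sum_of_nonneg fun t _ => by exact_mod_cast hW0 t, ENNReal.ofReal_le_one]
    exact_mod_cast hW1 T
  have hPlsc : LowerSemicomputable fun x => qval (P x) := by
    refine ⟨fun x _ => P x, ?_, fun x _ => ?_, fun x _ _ _ => le_rfl, fun x => by simp⟩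
    · have heq : Computable₂ fun a b : List Bool => decide (a = b) := Primrec.eq.decide.to_comp
      have hc : Computable P := (Computable.cond
        (heq.comp Computable.id (computable_zeros.comp Computable.list_length))
        (hW.comp Computable.list_length) (Computable.const 0)).of_eq fun x => by
          unfold P
          simp only [id]
          by_cases h : x = zeros x.length
          · rw [if_pos h, decide_eq_true h]; rfl
          · rw [if_neg h, decide_eq_false h]; rfl
      exact hc.comp Computable.fst
    · simp only [P]
      split_ifs
      exacts [hW0 _, le_rfl]
  obtain ⟨c, hc0, hc⟩ := huniv _ hPsemi hPlsc
  obtain ⟨C, hC⟩ := exists_nat_gt c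
  have hC0 : 0 < C := by
    have := hc0.trans hC
    exact_mod_cast this
  have hex' : ∀ t, ∃ s, W t ≤ C * mt (zeros t) s := by
    intro t
    rcases (hW0 t).eq_or_lt with h0 | h0
    · exact ⟨0, h0 ▸ mul_nonneg (Nat.cast_nonneg _) (hnn _ _)⟩
    have h1 : qval (W t) ≤ c * m (zeros t) := by simpa only [hPz] using hc (zeros t)
    have hpos : 0 < qval (W t) := ENNReal.ofReal_pos.2 (by exact_mod_cast h0)
    have hm0 : m (zeros t) ≠ 0 := fun h => by simp [h] at h1; simp [h1] at hpos
    have hmtop : m (zeros t) ≠ ⊤ :=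
      ((ENNReal.le_tsum _).trans hsemi).trans_lt ENNReal.one_lt_top |>.ne
    have h2 : qval (W t) < C * m (zeros t) :=
      h1.trans_lt (ENNReal.mul_lt_mul_left hm0 hmtop (by exact_mod_cast hC))
    rw [hsup, ENNReal.mul_iSup, lt_iSup_iff] at h2
    obtain ⟨s, hs⟩ := h2
    refine ⟨s, ?_⟩
    rw [qval, qval, ← ENNReal.ofReal_natCast, ← ENNReal.ofReal_mul (Nat.cast_nonneg _)] at hs
    have := (ENNReal.ofReal_lt_ofReal_iff_of_nonneg (by exact_mod_cast hW0 t)).1 hs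
    exact_mod_cast this.le
  let R : ℕ → ℕ → Prop := fun t s =>
    (W t).num.toNat * (mt (zeros t) s).den ≤ C * (mt (zeros t) s).num.toNat * (W t).den
  have hRd : DecidableRel R := fun t s => by unfold R; infer_instance
  have hR : ∀ t s, R t s ↔ W t ≤ C * mt (zeros t) s :=
    fun t s => Rat.num_den_le_iff C (hW0 t) (hnn (zeros t) s)
  have hex : ∀ t, ∃ s, R t s := fun t => (hex' t).imp fun s => (hR t s).2
  have hRc : ComputablePred fun p : ℕ × ℕ => R p.1 p.2 := by
    refine ⟨fun p => hRd p.1 p.2, ?_⟩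
    have hw : Computable fun p : ℕ × ℕ => W p.1 := hW.comp Computable.fst
    have hz : Computable fun p : ℕ × ℕ => mt (zeros p.1) p.2 :=
      Computable.comp (g := fun p : ℕ × ℕ => (zeros p.1, p.2)) hcomp
        ((computable_zeros.comp Computable.fst).pair Computable.snd)
    have hmul : Computable₂ fun a b : ℕ => a * b := Primrec.nat_mul.to_comp
    have hle : Computable₂ fun a b : ℕ => decide (a ≤ b) := Primrec.nat_le.decide.to_comp
    exact (hle.comp
      (hmul.comp (computable_rat_num_toNat.comp hw) (computable_rat_den.comp hz))
      (hmul.comp (hmul.comp (Computable.const C) (computable_rat_num_toNat.comp hz))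
        (computable_rat_den.comp hw))).of_eq fun p => by simp [R]
  exact ⟨C, fun t => Nat.find (hex t), hC0, Computable.find hRc hex, fun t =>
    (hR t _).1 (Nat.find_spec (hex t))⟩

/-! ### Dyadic approximations of the total mass -/

/-- The numerator of the dyadic approximation at stage `t` to the weight of the string coded
by `i`. -/
def codedDyadicFloor (mt : List Bool → ℕ → ℚ) (t i : ℕ) : ℕ :=
  ((Encodable.decode₂ (List Bool) i).map fun x => dyadicFloor (mt x t) t).getD 0

/-- The numerator of the dyadic approximation at stage `t` to the total mass, over the
denominator `2 ^ t`. -/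
def dyadicMass (mt : List Bool → ℕ → ℚ) (t : ℕ) : ℕ :=
  ∑ i ∈ Finset.range t, codedDyadicFloor mt t i

lemma codedDyadicFloor_encode (mt : List Bool → ℕ → ℚ) (t : ℕ) (x : List Bool) :
    codedDyadicFloor mt t (Encodable.encode x) = dyadicFloor (mt x t) t := by
  simp [codedDyadicFloor]

lemma codedDyadicFloor_of_notMem_range (mt : List Bool → ℕ → ℚ) (t : ℕ) {i : ℕ}
    (hi : i ∉ Set.range (Encodable.encode : List Bool → ℕ)) : codedDyadicFloor mt t i = 0 := by
  have : Encodable.decode₂ (List Bool) i = none := by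
    by_contra h
    obtain ⟨x, hx⟩ := Option.ne_none_iff_exists'.1 h
    exact hi ⟨x, Encodable.decode₂_eq_some.1 hx⟩
  simp [codedDyadicFloor, this]

lemma computable_dyadicMass {mt : List Bool → ℕ → ℚ}
    (hmt : Computable fun p : List Bool × ℕ => mt p.1 p.2) : Computable (dyadicMass mt) := by
  refine Computable.sum_range Computable.id ?_
  refine Computable.option_getD (Computable.option_map
    (Primrec.decode₂.to_comp.comp Computable.snd) ?_) (Computable.const 0)
  have ht : Computable fun p : (ℕ × ℕ) × List Bool => p.1.1 :=
    Computable.fst.comp Computable.fst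
  exact computable_dyadicFloor.comp
    (Computable.comp (g := fun p : (ℕ × ℕ) × List Bool => (p.2, p.1.1)) hmt
      (Computable.snd.pair ht)) ht

lemma dyadicFloor_two_mul_le {a b : ℚ} (ha : 0 ≤ a) (hab : a ≤ b) (s : ℕ) :
    2 * dyadicFloor a s ≤ dyadicFloor b (s + 1) := by
  rw [dyadicFloor_eq_floor ha, dyadicFloor_eq_floor (ha.trans hab)]
  refine Nat.le_floor ?_
  have h1 : (⌊a * 2 ^ s⌋₊ : ℚ) ≤ a * 2 ^ s := Nat.floor_le (by positivity)
  have h2 : a * 2 ^ s ≤ b * 2 ^ s := by gcongr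
  rw [pow_succ]
  push_cast
  linarith

lemma dyadicFloor_div_le {q : ℚ} (hq : 0 ≤ q) (s : ℕ) :
    (dyadicFloor q s : ℝ≥0∞) / 2 ^ s ≤ qval q := by
  have h1 : (⌊q * 2 ^ s⌋₊ : ℚ) ≤ q * 2 ^ s := Nat.floor_le (by positivity)
  have h2 : (dyadicFloor q s : ℝ) ≤ q * 2 ^ s := by
    rw [dyadicFloor_eq_floor hq]
    exact_mod_cast h1
  rw [ENNReal.div_le_iff (by positivity) (by finiteness), qval]
  have := ENNReal.ofReal_le_ofReal h2
  rwa [ENNReal.ofReal_natCast, ENNReal.ofReal_mul (by exact_mod_cast hq),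
    ENNReal.ofReal_pow two_pos.le, ENNReal.ofReal_ofNat] at this

lemma qval_le_dyadicFloor_div_add {q : ℚ} (hq : 0 ≤ q) (s : ℕ) :
    qval q ≤ (dyadicFloor q s : ℝ≥0∞) / 2 ^ s + (1 / 2) ^ s := by
  have h1 : q * 2 ^ s < ⌊q * 2 ^ s⌋₊ + 1 := Nat.lt_floor_add_one _
  have h2 : (q : ℝ) * 2 ^ s ≤ dyadicFloor q s + 1 := by
    rw [dyadicFloor_eq_floor hq]
    exact_mod_cast h1.le
  have h3 : (1 / 2 : ℝ≥0∞) ^ s = 1 / 2 ^ s := by simp [ENNReal.inv_pow]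
  rw [h3, ENNReal.div_add_div_same, ENNReal.le_div_iff_mul_le (by simp) (by simp), qval]
  have := ENNReal.ofReal_le_ofReal h2
  rwa [ENNReal.ofReal_mul (by exact_mod_cast hq), ENNReal.ofReal_pow two_pos.le,
    ENNReal.ofReal_ofNat, ENNReal.ofReal_add (by positivity) zero_le_one,
    ENNReal.ofReal_natCast, ENNReal.ofReal_one] at this

section Mass

variable {m : List Bool → ℝ≥0∞} {mt : List Bool → ℕ → ℚ}

lemma codedDyadicFloor_two_mul_le (hmt : IsApproxFromBelow m mt) (t i : ℕ) :
    2 * codedDyadicFloor mt t i ≤ codedDyadicFloor mt (t + 1) i := by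
  by_cases hi : i ∈ Set.range (Encodable.encode : List Bool → ℕ)
  · obtain ⟨x, rfl⟩ := hi
    simp only [codedDyadicFloor_encode]
    exact dyadicFloor_two_mul_le (hmt.2.1 x t) (hmt.2.2.1 x t.le_succ) t
  · simp [codedDyadicFloor_of_notMem_range mt t hi]

lemma codedDyadicFloor_div_mono (hmt : IsApproxFromBelow m mt) (i : ℕ) :
    Monotone fun t => (codedDyadicFloor mt t i : ℝ≥0∞) / 2 ^ t := by
  refine monotone_nat_of_le_succ fun t => ?_
  rw [← ENNReal.mul_div_mul_left (codedDyadicFloor mt t i : ℝ≥0∞) (2 ^ t) two_ne_zero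
    ENNReal.ofNat_ne_top, ← pow_succ']
  gcongr
  exact_mod_cast codedDyadicFloor_two_mul_le hmt t i

lemma dyadicMass_two_mul_le (hmt : IsApproxFromBelow m mt) (t : ℕ) :
    2 * dyadicMass mt t ≤ dyadicMass mt (t + 1) := by
  rw [dyadicMass, dyadicMass, Finset.mul_sum]
  exact (Finset.sum_le_sum fun i _ => codedDyadicFloor_two_mul_le hmt t i).trans
    (Finset.sum_le_sum_of_subset (Finset.range_mono t.le_succ))

lemma dyadicMass_div_eq (mt : List Bool → ℕ → ℚ) (t : ℕ) :
    (dyadicMass mt t : ℝ≥0∞) / 2 ^ t =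
      ∑ i ∈ Finset.range t, (codedDyadicFloor mt t i : ℝ≥0∞) / 2 ^ t := by
  simp [dyadicMass, div_eq_mul_inv, Finset.sum_mul]

lemma dyadicMass_div_le_tsum (hmt : IsApproxFromBelow m mt) (t : ℕ) :
    (dyadicMass mt t : ℝ≥0∞) / 2 ^ t ≤ ∑' x, qval (mt x t) := by
  rw [dyadicMass_div_eq]
  refine (ENNReal.sum_le_tsum _).trans ?_
  rw [← (Encodable.encode_injective (α := List Bool)).tsum_eq]
  · refine ENNReal.tsum_le_tsum fun x => ?_
    rw [codedDyadicFloor_encode]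
    exact dyadicFloor_div_le (hmt.2.1 x t) t
  · intro i hi
    by_contra h
    exact hi (by simp [codedDyadicFloor_of_notMem_range mt t h])

lemma qval_le_of_isApproxFromBelow (hmt : IsApproxFromBelow m mt) (x : List Bool) (t : ℕ) :
    qval (mt x t) ≤ m x := by
  rw [hmt.2.2.2 x]
  exact le_iSup (fun s => qval (mt x s)) t

lemma dyadicMass_le (hm : IsSemimeasure m) (hmt : IsApproxFromBelow m mt) (t : ℕ) :
    dyadicMass mt t ≤ 2 ^ t := by
  have h := (dyadicMass_div_le_tsum hmt t).trans
    ((ENNReal.tsum_le_tsum fun x => qval_le_of_isApproxFromBelow hmt x t).trans hm)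
  rw [ENNReal.div_le_iff (by positivity) (by finiteness), one_mul] at h
  exact_mod_cast h

lemma le_iSup_dyadicFloor_div (hmt : IsApproxFromBelow m mt) (x : List Bool) :
    m x ≤ ⨆ t, (dyadicFloor (mt x t) t : ℝ≥0∞) / 2 ^ t := by
  rw [hmt.2.2.2 x]
  refine iSup_le fun s => ?_
  have hlim : Filter.Tendsto (fun t : ℕ =>
      (⨆ t, (dyadicFloor (mt x t) t : ℝ≥0∞) / 2 ^ t) + (1 / 2) ^ t) Filter.atTop
      (nhds ((⨆ t, (dyadicFloor (mt x t) t : ℝ≥0∞) / 2 ^ t) + 0)) :=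
    tendsto_const_nhds.add (ENNReal.tendsto_pow_atTop_nhds_zero_of_lt_one
      (by simp))
  rw [add_zero] at hlim
  refine ge_of_tendsto hlim (Filter.eventually_atTop.2 ⟨s, fun t hst => ?_⟩)
  have h1 : qval (mt x s) ≤ qval (mt x t) :=
    ENNReal.ofReal_le_ofReal (by exact_mod_cast hmt.2.2.1 x hst)
  refine (h1.trans (qval_le_dyadicFloor_div_add (hmt.2.1 x t) t)).trans ?_
  gcongr
  exact le_iSup (fun t => (dyadicFloor (mt x t) t : ℝ≥0∞) / 2 ^ t) t

lemma tsum_le_of_dyadicMass_div_le (hmt : IsApproxFromBelow m mt) {b : ℝ≥0∞}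
    (hb : ∀ t, (dyadicMass mt t : ℝ≥0∞) / 2 ^ t ≤ b) : ∑' x, m x ≤ b := by
  let G : ℕ → ℕ → ℝ≥0∞ := fun i t => (codedDyadicFloor mt t i : ℝ≥0∞) / 2 ^ t
  have h1 : ∑' x, m x ≤ ∑' i, ⨆ t, G i t := by
    have h2 := ENNReal.tsum_comp_le_tsum_of_injective
      (Encodable.encode_injective (α := List Bool)) fun i => ⨆ t, G i t
    refine (ENNReal.tsum_le_tsum fun x => ?_).trans h2
    simp only [G, codedDyadicFloor_encode]
    exact le_iSup_dyadicFloor_div hmt x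
  refine h1.trans (ENNReal.tsum_le_of_sum_range_le fun n => ?_)
  rw [ENNReal.finsetSum_iSup_of_monotone fun i => codedDyadicFloor_div_mono hmt i]
  refine iSup_le fun t => le_trans ?_ (hb (max n t))
  rw [dyadicMass_div_eq]
  refine le_trans (Finset.sum_le_sum fun i _ =>
    codedDyadicFloor_div_mono hmt i (le_max_right n t)) ?_
  exact Finset.sum_le_sum_of_subset (Finset.range_mono (le_max_left n t))

lemma dyadicMass_div_mono (hmt : IsApproxFromBelow m mt) :
    Monotone fun t => (dyadicMass mt t : ℝ≥0∞) / 2 ^ t := by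
  refine monotone_nat_of_le_succ fun t => ?_
  rw [← ENNReal.mul_div_mul_left (dyadicMass mt t : ℝ≥0∞) (2 ^ t) two_ne_zero
    ENNReal.ofNat_ne_top, ← pow_succ']
  gcongr
  exact_mod_cast dyadicMass_two_mul_le hmt t

lemma tsum_le_of_dyadicLevel_le (hmt : IsApproxFromBelow m mt) {k F : ℕ}
    (hF : ∀ t, dyadicLevel (dyadicMass mt) k t ≤ F) :
    ∑' x, m x ≤ (F + 1 : ℝ≥0∞) / 2 ^ k := by
  refine tsum_le_of_dyadicMass_div_le hmt fun t => ?_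
  obtain ⟨n, hn⟩ : ∃ n, t ≤ k + (n + 1) := ⟨t, by omega⟩
  refine (dyadicMass_div_mono hmt hn).trans ?_
  have h1 := hF (k + (n + 1))
  rw [dyadicLevel, if_pos (by omega), Nat.add_sub_cancel_left] at h1
  have h2 := (Nat.div_lt_iff_lt_mul (by positivity)).1 (Nat.lt_succ_of_le h1)
  have h3 : (dyadicMass mt (k + (n + 1)) : ℝ≥0∞) ≤ (F + 1) * 2 ^ (n + 1) := by
    exact_mod_cast h2.le
  simp only
  rw [pow_add, ← ENNReal.mul_div_mul_right (F + 1 : ℝ≥0∞) (2 ^ k) (c := 2 ^ (n + 1))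
    (by positivity) (by finiteness)]
  gcongr

lemma dyadicLevel_div_le_tsum (hmt : IsApproxFromBelow m mt) (k t : ℕ) :
    (dyadicLevel (dyadicMass mt) k t : ℝ≥0∞) / 2 ^ k ≤ ∑' x, qval (mt x t) := by
  unfold dyadicLevel
  split_ifs with h
  · refine le_trans ?_ (dyadicMass_div_le_tsum hmt t)
    obtain ⟨n, rfl⟩ := Nat.exists_eq_add_of_lt h
    have h1 := Nat.div_mul_le_self (dyadicMass mt (k + n + 1)) (2 ^ (k + n + 1 - k))
    rw [add_assoc, Nat.add_sub_cancel_left] at *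
    rw [pow_add, ← ENNReal.mul_div_mul_right _ (2 ^ k : ℝ≥0∞) (c := 2 ^ (n + 1))
      (by positivity) (by finiteness)]
    gcongr
    · exact_mod_cast h1
    · exact (pow_add _ _ _).le
  · simp

lemma tsum_tail_le (hm : IsSemimeasure m) (hmt : IsApproxFromBelow m mt) {t : ℕ} {ε : ℝ≥0∞}
    (h : ∑' x, m x ≤ ∑' x, qval (mt x t) + ε) :
    ∑' x : {x : List Bool // 2 * qval (mt x t) ≤ m x}, m x.1 ≤ 2 * ε := by
  have hle := fun x => qval_le_of_isApproxFromBelow hmt x t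
  have h1 : ∑' x, (m x - qval (mt x t)) ≤ ε := by
    have hne : ∑' x, qval (mt x t) ≠ ⊤ :=
      (((ENNReal.tsum_le_tsum hle).trans hm).trans_lt ENNReal.one_lt_top).ne
    refine (ENNReal.add_le_add_iff_right hne).1 ?_
    rw [← ENNReal.tsum_add, add_comm ε]
    simpa only [tsub_add_cancel_of_le (hle _)] using h
  calc ∑' x : {x : List Bool // 2 * qval (mt x t) ≤ m x}, m x.1
      ≤ ∑' x : {x : List Bool // 2 * qval (mt x t) ≤ m x}, 2 * (m x.1 - qval (mt x.1 t)) := by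
        refine ENNReal.tsum_le_tsum fun ⟨x, hx⟩ => ?_
        rw [ENNReal.mul_sub (by simp)]
        refine ENNReal.le_sub_of_add_le_left (by simp [qval, ENNReal.mul_eq_top]) ?_
        rw [two_mul (m x)]
        gcongr
    _ ≤ ∑' x, 2 * (m x - qval (mt x t)) :=
        ENNReal.tsum_comp_le_tsum_of_injective Subtype.val_injective
          fun x => 2 * (m x - qval (mt x t))
    _ ≤ 2 * ε := by
        rw [ENNReal.tsum_mul_left]
        gcongr

end Mass

lemma exists_dyadicLevel_attained {M : ℕ → ℕ} (hM1 : ∀ t, M t ≤ 2 ^ t) (k : ℕ) :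
    ∃ t, (∀ s, dyadicLevel M k s ≤ dyadicLevel M k t) ∧
      (0 < dyadicLevel M k t → k < t ∧ dyadicLevel M k (t - 1) < dyadicLevel M k t) := by
  have hex : ∃ t, ∀ s, dyadicLevel M k s ≤ dyadicLevel M k t := by
    have hbdd : BddAbove (Set.range (dyadicLevel M k)) :=
      ⟨2 ^ k, by rintro _ ⟨t, rfl⟩; exact dyadicLevel_le hM1 k t⟩
    obtain ⟨t, ht⟩ := Nat.sSup_mem (Set.range_nonempty _) hbdd
    exact ⟨t, fun s => ht ▸ le_csSup hbdd ⟨s, rfl⟩⟩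
  classical
  refine ⟨Nat.find hex, Nat.find_spec hex, fun hpos => ?_⟩
  have hk : k < Nat.find hex := by
    by_contra h
    rw [dyadicLevel, if_neg h] at hpos
    exact lt_irrefl _ hpos
  refine ⟨hk, ?_⟩
  have hmin := Nat.find_min hex (m := Nat.find hex - 1) (by omega)
  push Not at hmin
  obtain ⟨s, hs⟩ := hmin
  exact hs.trans_le (Nat.find_spec hex s)

lemma eventually_mul_le_sq (C : ℕ) :
    ∃ N : ℕ, 0 < N ∧ ∀ k, N ≤ k → C * ((k + 1) * (k.sqrt + 1)) ≤ k ^ 2 := by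
  refine ⟨(4 * C + 1) ^ 2, by positivity, fun k hk => ?_⟩
  have h1 : 4 * C + 1 ≤ k.sqrt := Nat.le_sqrt'.2 hk
  have h2 : k.sqrt ^ 2 ≤ k := Nat.sqrt_le' k
  have h3 : 1 ≤ k := by nlinarith
  calc C * ((k + 1) * (k.sqrt + 1)) ≤ C * ((2 * k) * (2 * k.sqrt)) := by gcongr <;> omega
    _ = k * ((4 * C) * k.sqrt) := by ring
    _ ≤ k * (k.sqrt * k.sqrt) := by gcongr; omega
    _ ≤ k * k := by gcongr; rwa [← sq]
    _ = k ^ 2 := (sq k).symm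

lemma tsum_ne_zero_of_isUniversal {m : List Bool → ℝ≥0∞} (hm : IsUniversalSemimeasure m) :
    ∑' x, m x ≠ 0 := by
  obtain ⟨mt, hmt⟩ := hm.2.1
  obtain ⟨c, f, hc, -, hf⟩ := exists_computable_stage hm hmt
    (W := fun t => if t = 0 then 1 else 0)
    (Primrec.ite (Primrec.eq.comp Primrec.id (Primrec.const 0)) (Primrec.const 1)
      (Primrec.const 0)).to_comp
    (fun t => by split_ifs <;> norm_num)
    (fun T => by rw [Finset.sum_ite_eq']; split_ifs <;> norm_num)
  intro h
  have h0 := ENNReal.tsum_eq_zero.1 h (zeros 0)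
  have h1 := qval_le_of_isApproxFromBelow hmt (zeros 0) (f 0)
  rw [h0, nonpos_iff_eq_zero, qval, ENNReal.ofReal_eq_zero] at h1
  have h2 : mt (zeros 0) (f 0) ≤ 0 := by exact_mod_cast h1
  have h3 := hf 0
  rw [if_pos rfl] at h3
  have h4 : (0 : ℚ) ≤ c := Nat.cast_nonneg c
  nlinarith

/-- Lemma 1: there are a sequence `t_1, t_2, …` and a computable `f` such that for all `k ≥ 1`
the `m`-measure of `{x : m(x) ≥ 2 m_{t_k}(x)}` is at most `2^{-k+1}`, and for all large `k`,
`m_{f(t_k)}(t_k) ≥ 2^{-k}/k²`. -/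
theorem exists_times_with_small_tail_and_large_approx
    (m : List Bool → ℝ≥0∞) (mt : List Bool → ℕ → ℚ)
    (hm : IsUniversalSemimeasure m) (hmt : IsApproxFromBelow m mt) :
    ∃ (t : ℕ → ℕ) (f : ℕ → ℕ), Computable f ∧
      (∀ k : ℕ, 1 ≤ k →
        ∑' x : {x : List Bool // 2 * qval (mt x (t k)) ≤ m x}, m x.1 ≤ 2 ^ (1 - (k : ℤ))) ∧
      (∃ N : ℕ, ∀ k : ℕ, N ≤ k →
        (2 : ℝ≥0∞) ^ (-(k : ℤ)) / (k : ℝ≥0∞) ^ 2 ≤ qval (mt (zeros (t k)) (f (t k)))) := by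
  obtain ⟨W, D, hD, hWc, hW0, hW1, hWlow⟩ := exists_computable_weight
    (computable_dyadicMass hmt.1) (dyadicMass_two_mul_le hmt) (dyadicMass_le hm.1 hmt)
  obtain ⟨c, f, hc, hfc, hf⟩ := exists_computable_stage hm hmt hWc hW0 hW1
  choose t htmax htpos using exists_dyadicLevel_attained (dyadicMass_le hm.1 hmt)
  refine ⟨t, f, hfc, fun k _ => ?_, ?_⟩
  · have h2 : (2 : ℝ≥0∞) ^ (1 - (k : ℤ)) = 2 * (1 / 2 ^ k) := by
      rw [sub_eq_add_neg, ENNReal.zpow_add two_ne_zero ENNReal.ofNat_ne_top, zpow_one,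
        ENNReal.zpow_neg, zpow_natCast, one_div]
    rw [h2]
    refine tsum_tail_le hm.1 hmt ((tsum_le_of_dyadicLevel_le hmt (htmax k)).trans ?_)
    rw [ENNReal.add_div]
    gcongr
    exact dyadicLevel_div_le_tsum hmt k (t k)
  · obtain ⟨N₁, hN₁, hN₁'⟩ := eventually_mul_le_sq (c * D)
    obtain ⟨N₂, hN₂⟩ : ∃ N : ℕ, (1 / 2 : ℝ≥0∞) ^ N < ∑' x, m x :=
      ((ENNReal.tendsto_pow_atTop_nhds_zero_of_lt_one (by simp)).eventually_lt_const
        (pos_iff_ne_zero.2 (tsum_ne_zero_of_isUniversal hm))).exists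
    refine ⟨max N₁ N₂, fun k hk => ?_⟩
    have hkN₁ : N₁ ≤ k := (le_max_left _ _).trans hk
    have hlevel : 0 < dyadicLevel (dyadicMass mt) k (t k) := by
      by_contra! h
      have h1 := tsum_le_of_dyadicLevel_le hmt fun s => (htmax k s).trans h
      refine (hN₂.trans_le h1).not_ge ?_
      have h3 : (1 / 2 : ℝ≥0∞) ^ k = 1 / 2 ^ k := by simp [ENNReal.inv_pow]
      rw [Nat.cast_zero, zero_add, ← h3]
      exact pow_le_pow_right_of_le_one' (by simp) ((le_max_right _ _).trans hk)
    obtain ⟨hkt, hlt⟩ := htpos k hlevel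
    have hlow := (hWlow k (t k) hkt hlt).trans (hf (t k))
    have hcq : (0 : ℚ) < c := by exact_mod_cast hc
    have hDq : (0 : ℚ) < D := by exact_mod_cast hD
    have hkq : (0 : ℚ) < k := by exact_mod_cast hN₁.trans_le hkN₁
    have hcost : (c * D * levelCost k : ℚ) ≤ 2 ^ k * k ^ 2 := by
      have h1 : c * D * levelCost k ≤ 2 ^ k * k ^ 2 := by
        rw [levelCost, mul_left_comm]
        gcongr
        exact hN₁' k hkN₁
      exact_mod_cast h1
    have hcost0 : (0 : ℚ) < levelCost k := by exact_mod_cast levelCost_pos k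
    have hq : 1 / (2 ^ k * k ^ 2 : ℚ) ≤ mt (zeros (t k)) (f (t k)) := by
      refine (one_div_le_one_div_of_le (by positivity) hcost).trans ?_
      rw [div_le_iff₀ (by positivity)] at hlow ⊢
      linarith
    have hr : 1 / (2 ^ k * k ^ 2 : ℝ) ≤ (mt (zeros (t k)) (f (t k)) : ℝ) := by
      have h1 : ((1 / (2 ^ k * k ^ 2 : ℚ) : ℚ) : ℝ) ≤ mt (zeros (t k)) (f (t k)) :=
        Rat.cast_le.2 hq
      simpa using h1
    refine le_trans (le_of_eq ?_) (ENNReal.ofReal_le_ofReal hr)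
    have hkr : (0 : ℝ) < k := by exact_mod_cast hkq
    rw [ENNReal.ofReal_div_of_pos (by positivity), ENNReal.ofReal_mul (by positivity),
      ENNReal.ofReal_pow two_pos.le, ENNReal.ofReal_pow hkr.le, ENNReal.ofReal_ofNat,
      ENNReal.ofReal_natCast, ENNReal.ofReal_one, ENNReal.zpow_neg, zpow_natCast,
      div_eq_mul_inv, one_div, ENNReal.mul_inv (by simp) (by simp)]
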